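/- If g₁, g₂ : ℝ → ℂ are almost periodic, h₁, h₂ : ℝ → ℂ vanish at infinity, and g₁ + h₁ = g₂ + h₂, then g₁ = g₂ and h₁ = h₂; i.e., the decomposition of a function of a real variable into an almost periodic part plus a part vanishing at infinity is unique when it exists. -/

import Mathlib

open Filter

/-- A trigonometric polynomial: a finite linear combination of the exponentials
`x ↦ exp(iμx)`, `μ ∈ ℝ`. -/
def IsTrigPoly (g : ℝ → ℂ) : Prop :=
  ∃ (m : ℕ) (c : Fin m → ℂ) (μ : Fin m → ℝ),
    ∀ x : ℝ, g x = ∑ i, c i * Complex.exp (Complex.I * (μ i : ℂ) * (x : ℂ))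

/-- `f : ℝ → ℂ` is almost periodic if it is a uniform limit on `ℝ` of trigonometric
polynomials. -/
def AlmostPeriodic (f : ℝ → ℂ) : Prop :=
  ∃ g : ℕ → ℝ → ℂ, (∀ n, IsTrigPoly (g n)) ∧ TendstoUniformly g f atTop

/-- The difference of two trigonometric polynomials is a trigonometric polynomial. -/
theorem IsTrigPoly.sub {p q : ℝ → ℂ} (hp : IsTrigPoly p) (hq : IsTrigPoly q) :
    IsTrigPoly (p - q) := by
  obtain ⟨m, c, μ, hp⟩ := hp
  obtain ⟨n, d, ν, hq⟩ := hq
  refine ⟨m + n, Fin.append c (-d), Fin.append μ ν, fun x => ?_⟩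
  simp [Fin.sum_univ_add, hp, hq, sub_eq_add_neg]

/-- The difference of two almost periodic functions is almost periodic. -/
theorem AlmostPeriodic.sub {f g : ℝ → ℂ} (hf : AlmostPeriodic f) (hg : AlmostPeriodic g) :
    AlmostPeriodic (f - g) := by
  obtain ⟨p, hp, hpf⟩ := hf
  obtain ⟨q, hq, hqg⟩ := hg
  exact ⟨p - q, fun n => (hp n).sub (hq n), hpf.sub hqg⟩

/-- Trigonometric polynomials are recurrent under integer translations. -/
theorem IsTrigPoly.mapClusterPt_add_natCast {p : ℝ → ℂ} (hp : IsTrigPoly p) (x : ℝ) :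
    MapClusterPt (p x) atTop (fun n : ℕ => p (x + n)) := by
  obtain ⟨m, c, μ, hp⟩ := hp
  let Φ : (Fin m → Circle) → ℂ :=
    fun w => ∑ i, c i * Complex.exp (Complex.I * μ i * x) * (w i : ℂ)
  have hΦ : Continuous Φ := by fun_prop
  have h := (mapClusterPt_one_atTop_pow (fun i => Circle.exp (μ i))).continuousAt_comp
    hΦ.continuousAt
  convert h using 1
  · simp [Φ, hp]
  · funext n
    simp only [hp, Φ, Function.comp_apply, Pi.pow_apply, Circle.coe_pow, Circle.coe_exp,
      ← Complex.exp_nat_mul, mul_assoc, ← Complex.exp_add]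
    refine Finset.sum_congr rfl fun i _ => ?_
    congr 2
    push_cast
    ring

/-- Almost periodic functions are recurrent under integer translations. -/
theorem AlmostPeriodic.mapClusterPt_add_natCast {f : ℝ → ℂ} (hf : AlmostPeriodic f) (x : ℝ) :
    MapClusterPt (f x) atTop (fun n : ℕ => f (x + n)) := by
  obtain ⟨g, hg, hgf⟩ := hf
  rw [Metric.nhds_basis_ball.mapClusterPt_iff_frequently]
  intro ε hε
  obtain ⟨k, hk⟩ := (Metric.tendstoUniformly_iff.1 hgf (ε / 3) (by positivity)).exists
  have h := (hg k).mapClusterPt_add_natCast x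
  rw [Metric.nhds_basis_ball.mapClusterPt_iff_frequently] at h
  refine (h (ε / 3) (by positivity)).mono fun n hn => ?_
  rw [Metric.mem_ball] at hn ⊢
  have h₁ := hk (x + n)
  have h₂ := hk x
  rw [dist_comm] at h₂
  linarith [dist_triangle4 (f (x + n)) (g k (x + n)) (g k x) (f x)]

/-- An almost periodic function vanishing at infinity is zero. -/
theorem AlmostPeriodic.eq_zero_of_tendsto_cocompact {f : ℝ → ℂ} (hf : AlmostPeriodic f)
    (h : Tendsto f (cocompact ℝ) (nhds 0)) : f = 0 := by
  funext x
  have hx : Tendsto (fun n : ℕ => f (x + n)) atTop (nhds 0) :=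
    (h.mono_left atTop_le_cocompact).comp
      (tendsto_atTop_add_const_left _ x tendsto_natCast_atTop_atTop)
  have : (nhds (f x) ⊓ nhds 0).NeBot := (hf.mapClusterPt_add_natCast x).clusterPt.mono hx
  exact eq_of_nhds_neBot this

/-- The decomposition of a function `ℝ → ℂ` into an almost periodic part plus a part vanishing
at infinity is unique when it exists. -/
theorem almostPeriodic_add_vanishing_decomposition_unique (g₁ g₂ h₁ h₂ : ℝ → ℂ)
    (hg₁ : AlmostPeriodic g₁) (hg₂ : AlmostPeriodic g₂)
    (hh₁ : Tendsto h₁ (cocompact ℝ) (nhds 0)) (hh₂ : Tendsto h₂ (cocompact ℝ) (nhds 0))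
    (heq : g₁ + h₁ = g₂ + h₂) :
    g₁ = g₂ ∧ h₁ = h₂ := by
  have hg : g₁ - g₂ = h₂ - h₁ := by rw [sub_eq_sub_iff_add_eq_add, heq, add_comm]
  have hlim : Tendsto (g₁ - g₂) (cocompact ℝ) (nhds 0) := by
    rw [hg]
    exact sub_zero (0 : ℂ) ▸ hh₂.sub hh₁
  have h : g₁ = g₂ := sub_eq_zero.1 ((hg₁.sub hg₂).eq_zero_of_tendsto_cocompact hlim)
  exact ⟨h, add_left_cancel (h ▸ heq)⟩
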